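/- arXiv:2111.00693 — 2 statements merged into one kernel-verified Lean document; each statement's English description precedes it below -/
import Mathlib

section
/- Let ℬ be a Markushevich basis of 𝕏 having the FDSP with constant M, fix 0 < s ≤ 1 and m ∈ ℕ, and suppose L > 0 is such that for every x ∈ 𝕏 there exist A ∈ 𝒢(x,m,s) and y ∈ 𝕏 with supp(y) ⊆ A and ‖x − y‖ ≤ L·σ_m(x). Then for every x ∈ 𝕏, every A ∈ 𝒢(x,m,1), every B ⊂ ℕ with |B| = m and every ε ∈ E_B: min_{n∈A}|x_n*(x)|·‖1_{ε,B}‖ ≤ L²·M·(1+M)·s⁻²·‖x‖. If m is even, the stronger bound min_{n∈A}|x_n*(x)|·‖1_{ε,B}‖ ≤ 2L²·M·s⁻²·‖x‖ holds. If m is odd with m > 1 and L′ > 0 is such that for every x ∈ 𝕏 there exist A ∈ 𝒢(x,m−1,s) and y with supp(y) ⊆ A and ‖x − y‖ ≤ L′·σ_{m−1}(x), then min_{n∈A}|x_n*(x)|·‖1_{ε,B}‖ ≤ (2L′²·M·s⁻² + λλ′)·‖x‖; for m = 1 the bound λλ′·‖x‖ holds. -/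
open scoped BigOperators ENNReal
open Filter

noncomputable section

namespace GreedyPaper

variable {𝕜 : Type*} [RCLike 𝕜] {X : Type*} [NormedAddCommGroup X] [NormedSpace 𝕜 X]

/-- Support of `x` with respect to the coordinate functionals `f`. -/
def msupp (f : ℕ → X →L[𝕜] 𝕜) (x : X) : Set ℕ := {i | f i x ≠ 0}

/-- Projection onto a finite set of coordinates. -/
def proj (e : ℕ → X) (f : ℕ → X →L[𝕜] 𝕜) (A : Finset ℕ) (x : X) : X :=
  ∑ i ∈ A, f i x • e i

/-- `A` is an `m`-`t`-greedy set for `x`: `|A| = m` and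
`min_{j ∈ A} |f j x| ≥ t · sup_{k ∉ A} |f k x|`. -/
def GreedySet (f : ℕ → X →L[𝕜] 𝕜) (x : X) (m : ℕ) (t : ℝ) (A : Finset ℕ) : Prop :=
  A.card = m ∧ ∀ j ∈ A, ∀ k ∉ A, t * ‖f k x‖ ≤ ‖f j x‖

/-- `w`-measure of a set of indices, with value in `ℝ≥0∞` (possibly infinite). -/
def wsum (w : ℕ → ℝ) (S : Set ℕ) : ℝ≥0∞ := ∑' i : S, ENNReal.ofReal (w i)

/-- Sign of a scalar: `sgn 0 = 1` and `sgn t * t = |t|`. -/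
def sgn (t : 𝕜) : 𝕜 := if t = 0 then 1 else (‖t‖ : 𝕜) / t

/-- A Markushevich basis (with the boundedness assumptions of the paper):
biorthogonality, dense span, totality of the coordinate functionals, and boundedness
of both the basis vectors and the coordinate functionals. -/
structure IsMarkushevichBasis (e : ℕ → X) (f : ℕ → X →L[𝕜] 𝕜) : Prop where
  biorth : ∀ i j, f i (e j) = if i = j then 1 else 0
  dense_span : Dense ((Submodule.span 𝕜 (Set.range e) : Submodule 𝕜 X) : Set X)
  total : ∀ x : X, (∀ i, f i x = 0) → x = 0
  bddE : BddAbove (Set.range fun i => ‖e i‖)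
  bddF : BddAbove (Set.range fun i => ‖f i‖)

/-- `ℬ` is `C`-`s`-`w`-semi-greedy: for every `x` and `m` there are an `m`-`s`-greedy set `A`
and `y` supported in `A` with `‖x - y‖ ≤ C · inf {‖x - z‖ : supp z finite, w(supp z) ≤ w(A)}`. -/
def SemiGreedy (e : ℕ → X) (f : ℕ → X →L[𝕜] 𝕜) (w : ℕ → ℝ) (C s : ℝ) : Prop :=
  ∀ (x : X) (m : ℕ), ∃ A : Finset ℕ, GreedySet f x m s A ∧
    ∃ y : X, msupp f y ⊆ (A : Set ℕ) ∧
      ∀ z : X, (msupp f z).Finite → wsum w (msupp f z) ≤ wsum w (A : Set ℕ) →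
        ‖x - y‖ ≤ C * ‖x - z‖

/-- `ℬ` is `C`-`s`-`w`-almost semi-greedy. -/
def AlmostSemiGreedy (e : ℕ → X) (f : ℕ → X →L[𝕜] 𝕜) (w : ℕ → ℝ) (C s : ℝ) : Prop :=
  ∀ (x : X) (m : ℕ), ∃ A : Finset ℕ, GreedySet f x m s A ∧
    ∃ y : X, msupp f y ⊆ (A : Set ℕ) ∧
      ∀ B : Finset ℕ, wsum w (B : Set ℕ) ≤ wsum w (A : Set ℕ) →
        ‖x - y‖ ≤ C * ‖x - proj e f B x‖

/-- `ℬ` is `C`-`w`-almost greedy. -/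
def AlmostGreedy (e : ℕ → X) (f : ℕ → X →L[𝕜] 𝕜) (w : ℕ → ℝ) (C : ℝ) : Prop :=
  ∀ (x : X) (m : ℕ) (A : Finset ℕ), GreedySet f x m 1 A →
    ∀ B : Finset ℕ, wsum w (B : Set ℕ) ≤ wsum w (A : Set ℕ) →
      ‖x - proj e f A x‖ ≤ C * ‖x - proj e f B x‖

/-- `ℬ` is `C`-`w`-disjoint almost greedy. -/
def DisjointAlmostGreedy (e : ℕ → X) (f : ℕ → X →L[𝕜] 𝕜) (w : ℕ → ℝ) (C : ℝ) : Prop :=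
  ∀ (x : X) (m : ℕ) (A : Finset ℕ), GreedySet f x m 1 A →
    ∀ B : Finset ℕ, wsum w (B : Set ℕ) ≤ wsum w (A : Set ℕ) → Disjoint B A →
      ‖x - proj e f A x‖ ≤ C * ‖x - proj e f B x‖

/-- `ℬ` is `C`-`s`-`w`-almost greedy in the weak sense. -/
def WeakAlmostGreedy (e : ℕ → X) (f : ℕ → X →L[𝕜] 𝕜) (w : ℕ → ℝ) (C s : ℝ) : Prop :=
  ∀ (x : X) (m : ℕ), ∃ A : Finset ℕ, GreedySet f x m s A ∧
    ∀ B : Finset ℕ, wsum w (B : Set ℕ) ≤ wsum w (A : Set ℕ) →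
      ‖x - proj e f A x‖ ≤ C * ‖x - proj e f B x‖

/-- `ℬ` is `C`-`w`-superdemocratic. -/
def SuperDemocratic (e : ℕ → X) (f : ℕ → X →L[𝕜] 𝕜) (w : ℕ → ℝ) (C : ℝ) : Prop :=
  ∀ (A B : Finset ℕ) (ε ε' : ℕ → 𝕜), (∀ i ∈ A, ‖ε i‖ = 1) → (∀ i ∈ B, ‖ε' i‖ = 1) →
    wsum w (A : Set ℕ) ≤ wsum w (B : Set ℕ) →
      ‖∑ i ∈ A, ε i • e i‖ ≤ C * ‖∑ i ∈ B, ε' i • e i‖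

/-- `ℬ` is `C`-`w`-democratic. -/
def Democratic (e : ℕ → X) (f : ℕ → X →L[𝕜] 𝕜) (w : ℕ → ℝ) (C : ℝ) : Prop :=
  ∀ A B : Finset ℕ, wsum w (A : Set ℕ) ≤ wsum w (B : Set ℕ) →
    ‖∑ i ∈ A, e i‖ ≤ C * ‖∑ i ∈ B, e i‖

/-- `ℬ` is `C`-truncation quasi-greedy. -/
def TruncationQuasiGreedy (e : ℕ → X) (f : ℕ → X →L[𝕜] 𝕜) (C : ℝ) : Prop :=
  ∀ (x : X) (m : ℕ) (A : Finset ℕ) (hA : A.Nonempty), GreedySet f x m 1 A →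
    (A.inf' hA fun i => ‖f i x‖) * ‖∑ i ∈ A, sgn (f i x) • e i‖ ≤ C * ‖x‖

/-- `ℬ` has the `C`-`w`-Property (A). -/
def PropertyA (e : ℕ → X) (f : ℕ → X →L[𝕜] 𝕜) (w : ℕ → ℝ) (C : ℝ) : Prop :=
  ∀ x : X, (∀ i, ‖f i x‖ ≤ 1) →
    ∀ A B : Finset ℕ, wsum w (A : Set ℕ) ≤ wsum w (B : Set ℕ) → Disjoint A B →
      (∀ i ∈ A ∪ B, f i x = 0) →
      ∀ ε ε' : ℕ → 𝕜, (∀ i ∈ A, ‖ε i‖ = 1) → (∀ i ∈ B, ‖ε' i‖ = 1) →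
        ‖x + ∑ i ∈ A, ε i • e i‖ ≤ C * ‖x + ∑ i ∈ B, ε' i • e i‖

/-- The finite dimensional separation property (FDSP) with constant `M`. -/
def FDSP (e : ℕ → X) (M : ℝ) : Prop :=
  ∀ Z : Submodule 𝕜 X, IsClosed (Z : Set X) → TopologicalSpace.IsSeparable (Z : Set X) →
    ∀ ε : ℝ, 0 < ε → ∃ k : ℕ → ℕ, StrictMono k ∧
      (∀ (a : ℕ → 𝕜) (n l : ℕ), n ≤ l →
        ‖∑ j ∈ Finset.range (n + 1), a j • e (k j)‖ ≤
          (M + ε) * ‖∑ j ∈ Finset.range (l + 1), a j • e (k j)‖) ∧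
      (∀ F : Submodule 𝕜 X, F ≤ Z → FiniteDimensional 𝕜 F →
        ∃ N : ℕ, ∀ x ∈ F,
          ∀ z ∈ closure ((Submodule.span 𝕜 {v : X | ∃ n, N < n ∧ v = e (k n)} :
              Submodule 𝕜 X) : Set X),
            ‖x‖ ≤ (M + ε) * ‖x + z‖)

/-- `v` is a block basis of `e`. -/
def IsBlockBasis (e v : ℕ → X) : Prop :=
  ∃ (b : ℕ → 𝕜) (n m : ℕ → ℕ), (∀ i, n i ≤ m i) ∧ (∀ i, m i < n (i + 1)) ∧
    (∀ i, v i = ∑ k ∈ Finset.Icc (n i) (m i), b k • e k) ∧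
    (∀ i, ∃ k ∈ Finset.Icc (n i) (m i), b k ≠ 0)

/-- Every `x` has an `m`-`s`-greedy set `A` and a vector supported in `A` whose distance to `x` is
at most `L` times the error of the best `m`-term approximation to `x`. -/
def HasGreedyApprox (f : ℕ → X →L[𝕜] 𝕜) (m : ℕ) (s L : ℝ) : Prop :=
  ∀ x : X, ∃ A : Finset ℕ, GreedySet f x m s A ∧
    ∃ y : X, msupp f y ⊆ (A : Set ℕ) ∧
      ∀ z : X, (msupp f z).Finite → (msupp f z).ncard ≤ m → ‖x - y‖ ≤ L * ‖x - z‖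

variable {e : ℕ → X} {f : ℕ → X →L[𝕜] 𝕜} {m : ℕ} {s L M : ℝ}

namespace IsMarkushevichBasis

theorem apply_sum (hb : IsMarkushevichBasis e f) (B : Finset ℕ) (g : ℕ → 𝕜) (j : ℕ) :
    f j (∑ i ∈ B, g i • e i) = if j ∈ B then g j else 0 := by
  simp [hb.biorth]

theorem msupp_sum_subset (hb : IsMarkushevichBasis e f) (B : Finset ℕ) (g : ℕ → 𝕜) :
    msupp f (∑ i ∈ B, g i • e i) ⊆ (B : Set ℕ) := by
  intro j hj
  by_contra h
  exact hj (by rw [hb.apply_sum, if_neg (by simpa using h)])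

theorem eq_sum_of_msupp_subset (hb : IsMarkushevichBasis e f) {A : Finset ℕ} {y : X}
    (hy : msupp f y ⊆ (A : Set ℕ)) : y = ∑ i ∈ A, f i y • e i := by
  refine sub_eq_zero.1 (hb.total _ fun j => ?_)
  rw [map_sub, hb.apply_sum]
  split_ifs with h
  · simp
  · have : f j y = 0 := by
      by_contra h0
      exact h (by simpa using hy h0)
    simp [this]

theorem ne_zero (hb : IsMarkushevichBasis e f) (i : ℕ) : e i ≠ 0 := by
  intro h
  simpa [h] using hb.biorth i i

theorem isSeparable_univ (hb : IsMarkushevichBasis e f) :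
    TopologicalSpace.IsSeparable (Set.univ : Set X) := by
  rw [← hb.dense_span.closure_eq]
  exact ((Set.countable_range e).isSeparable.span (R := 𝕜)).closure

theorem norm_apply_le (hb : IsMarkushevichBasis e f) (i : ℕ) (x : X) :
    ‖f i x‖ ≤ (⨆ i, ‖f i‖) * ‖x‖ :=
  (f i).le_of_opNorm_le (le_ciSup hb.bddF i) x

theorem finite_setOf_le_norm_apply (hb : IsMarkushevichBasis e f) (x : X) {δ : ℝ} (hδ : 0 < δ) :
    {i | δ ≤ ‖f i x‖}.Finite := by
  have hK : 0 ≤ ⨆ i, ‖f i‖ := Real.iSup_nonneg fun i => norm_nonneg _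
  set K := ⨆ i, ‖f i‖
  obtain ⟨w, hw, hxw⟩ := Metric.mem_closure_iff.1 (hb.dense_span x) (δ / (K + 1)) (by positivity)
  obtain ⟨c, rfl⟩ := (Finsupp.mem_span_range_iff_exists_finsupp).1 hw
  refine c.support.finite_toSet.subset fun i hi => ?_
  by_contra hic
  have h0 : f i (c.sum fun j a => a • e j) = 0 := by
    rw [Finsupp.sum, hb.apply_sum, if_neg (by simpa using hic)]
  have h1 := hb.norm_apply_le i (x - c.sum fun j a => a • e j)
  rw [map_sub, h0, sub_zero, ← dist_eq_norm] at h1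
  rw [lt_div_iff₀ (by positivity)] at hxw
  have h2 : δ ≤ ‖f i x‖ := hi
  nlinarith [dist_nonneg (x := x) (y := c.sum fun j a => a • e j)]

end IsMarkushevichBasis

/-- Basis vectors far along a separating sequence are `(M + η)`-separated from a finite dimensional
subspace. -/
theorem FDSP.exists_infinite_separated (hb : IsMarkushevichBasis e f) (hM : FDSP (𝕜 := 𝕜) e M)
    {η : ℝ} (hη : 0 < η) (F : Submodule 𝕜 X) [FiniteDimensional 𝕜 F] :
    ∃ S : Set ℕ, S.Infinite ∧ ∀ u ∈ F, ∀ D : Finset ℕ, (D : Set ℕ) ⊆ S → ∀ g : ℕ → 𝕜,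
      ‖u‖ ≤ (M + η) * ‖u + ∑ i ∈ D, g i • e i‖ := by
  obtain ⟨k, hk, -, h⟩ := hM ⊤ isClosed_univ hb.isSeparable_univ η hη
  obtain ⟨N, hN⟩ := h F le_top inferInstance
  refine ⟨k '' Set.Ioi N, (Set.Ioi_infinite N).image hk.injective.injOn, fun u hu D hD g =>
    hN u hu _ (subset_closure ?_)⟩
  refine Submodule.sum_mem _ fun i hi => Submodule.smul_mem _ _ (Submodule.subset_span ?_)
  obtain ⟨n, hn, rfl⟩ := hD hi
  exact ⟨n, hn, rfl⟩

theorem FDSP.nonneg (hb : IsMarkushevichBasis e f) (hM : FDSP (𝕜 := 𝕜) e M) : 0 ≤ M := by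
  refine le_of_forall_pos_le_add fun η hη => ?_
  obtain ⟨S, -, h⟩ := hM.exists_infinite_separated hb hη (Submodule.span 𝕜 {e 0})
  have h0 := h (e 0) (Submodule.mem_span_singleton_self _) ∅ (by simp) 0
  rw [Finset.sum_empty, add_zero] at h0
  have := norm_pos_iff.2 (hb.ne_zero 0)
  by_contra! hneg
  nlinarith

/-- The norm of a signed sum over `B` is controlled by that of a signed sum over a separated set of
`m` indices. -/
theorem HasGreedyApprox.norm_sum_le_of_separated (hb : IsMarkushevichBasis e f)
    (hG : HasGreedyApprox f m s L) {M' c : ℝ} (hM' : 0 ≤ M') (hc : 0 ≤ c) (hsc : 1 < s * c)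
    {B D : Finset ℕ} (hBm : B.card ≤ m) (hDm : D.card = m) (hBD : Disjoint B D) {ε ε' : ℕ → 𝕜}
    (hε : ∀ i ∈ B, ‖ε i‖ = 1) (hε' : ∀ i ∈ D, ‖ε' i‖ = 1)
    (hsep : ∀ g : ℕ → 𝕜, ‖∑ i ∈ B, ε i • e i‖ ≤
      M' * ‖∑ i ∈ B, ε i • e i + ∑ i ∈ D, g i • e i‖) :
    ‖∑ i ∈ B, ε i • e i‖ ≤ M' * (L * (c * ‖∑ i ∈ D, ε' i • e i‖)) := by
  obtain ⟨C, ⟨hCm, hC⟩, y, hy, hyz⟩ :=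
    hG (∑ i ∈ B, ε i • e i + (c : 𝕜) • ∑ i ∈ D, ε' i • e i)
  have hCD : C = D := by
    by_contra hne
    obtain ⟨j, hjD, hjC⟩ : ∃ j ∈ D, j ∉ C := by
      by_contra! h
      exact hne (Finset.eq_of_subset_of_card_le h (by omega)).symm
    obtain ⟨i, hiC, hiD⟩ : ∃ i ∈ C, i ∉ D := by
      by_contra! h
      exact hne (Finset.eq_of_subset_of_card_le h (by omega))
    have hjB : j ∉ B := fun h => Finset.disjoint_left.1 hBD h hjD
    have h := hC i hiC j hjC
    rw [map_add, map_add, map_smul, map_smul] at h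
    simp only [hb.apply_sum, hjB, hjD, hiD, if_true, if_false, smul_zero, add_zero, zero_add,
      norm_smul, hε' j hjD, RCLike.norm_ofReal, abs_of_nonneg hc, mul_one] at h
    have h1 : ‖if i ∈ B then ε i else 0‖ ≤ 1 := by
      split_ifs with hi
      · exact (hε i hi).le
      · simp
    linarith
  subst hCD
  have hsub := hb.msupp_sum_subset B ε
  have h1 := hyz (∑ i ∈ B, ε i • e i) (B.finite_toSet.subset hsub)
    ((Set.ncard_le_ncard hsub B.finite_toSet).trans (by simpa using hBm))
  rw [add_sub_cancel_left, norm_smul, RCLike.norm_ofReal, abs_of_nonneg hc] at h1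
  refine (hsep fun i => (c : 𝕜) * ε' i - f i y).trans (mul_le_mul_of_nonneg_left ?_ hM')
  simp only [sub_smul, Finset.sum_sub_distrib, mul_smul]
  rwa [← hb.eq_sum_of_msupp_subset hy, ← Finset.smul_sum, ← add_sub_assoc]

/-- Adding to `x` a small signed sum over new indices costs at most a factor `L`, up to a vector
supported in the set of large coefficients of `x`. -/
theorem HasGreedyApprox.exists_norm_sub_add_le (hb : IsMarkushevichBasis e f)
    (hG : HasGreedyApprox f m s L) (hs0 : 0 < s) (hs1 : s ≤ 1) {x : X} {a b : ℝ} (ha : 0 ≤ a)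
    (hb0 : 0 ≤ b) {A D E : Finset ℕ} (hAm : A.card = m) (hDm : D.card ≤ m)
    (hA : ∀ i ∈ A, a ≤ ‖f i x‖) (hE : ∀ i, s * a ≤ ‖f i x‖ → i ∈ E)
    (hD : ∀ i ∈ D, ‖f i x‖ + b < s * a) :
    ∃ y ∈ Submodule.span 𝕜 (e '' E), ‖x - y + (b : 𝕜) • ∑ i ∈ D, e i‖ ≤ L * ‖x‖ := by
  have hcoord : ∀ j, f j (x + (b : 𝕜) • ∑ i ∈ D, e i) = f j x + if j ∈ D then (b : 𝕜) else 0 := by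
    intro j
    have := hb.apply_sum D (fun _ => 1) j
    simp only [one_smul] at this
    rw [map_add, map_smul, this]
    split_ifs <;> simp
  have hsa : s * a ≤ a := mul_le_of_le_one_left ha hs1
  have hAD : ∀ i ∈ A, i ∉ D := fun i hi hiD => by linarith [hA i hi, hD i hiD]
  obtain ⟨C, ⟨hCm, hC⟩, y, hy, hyz⟩ := hG (x + (b : 𝕜) • ∑ i ∈ D, e i)
  have hCE : C ⊆ E := by
    intro i hi
    by_cases hAC : A ⊆ C
    · have hAC' := Finset.eq_of_subset_of_card_le hAC (by omega)
      exact hE i (hsa.trans (hA i (hAC' ▸ hi)))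
    · obtain ⟨j, hjA, hjC⟩ := Finset.not_subset.1 hAC
      have h := hC i hi j hjC
      rw [hcoord, hcoord, if_neg (hAD j hjA), add_zero] at h
      have h1 : s * a ≤ s * ‖f j x‖ := mul_le_mul_of_nonneg_left (hA j hjA) hs0.le
      by_cases hiD : i ∈ D
      · rw [if_pos hiD] at h
        have h2 := norm_add_le (f i x) (b : 𝕜)
        rw [RCLike.norm_ofReal, abs_of_nonneg hb0] at h2
        linarith [hD i hiD]
      · rw [if_neg hiD, add_zero] at h
        exact hE i (h1.trans h)
  refine ⟨y, ?_, ?_⟩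
  · rw [hb.eq_sum_of_msupp_subset hy]
    exact Submodule.sum_mem _ fun i hi => Submodule.smul_mem _ _
      (Submodule.subset_span ⟨i, hCE hi, rfl⟩)
  · have hsub := hb.msupp_sum_subset D (fun _ => (b : 𝕜))
    rw [← Finset.smul_sum] at hsub
    have h1 := hyz _ (D.finite_toSet.subset hsub)
      ((Set.ncard_le_ncard hsub D.finite_toSet).trans (by simpa using hDm))
    rwa [add_sub_cancel_right, add_sub_right_comm] at h1

/-- Far separated indices at which `x` has small coefficients, together with the finite dimensional
space generated by `x`, the basis vectors at its large coefficients, and those in `B`. -/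
theorem exists_separated_indices (hb : IsMarkushevichBasis e f) (hM : FDSP (𝕜 := 𝕜) e M)
    {η δ κ : ℝ} (hη : 0 < η) (hδ : 0 < δ) (hκ : 0 < κ) (x : X) (B : Finset ℕ) :
    ∃ (E : Finset ℕ) (F : Submodule 𝕜 X) (S : Set ℕ), FiniteDimensional 𝕜 F ∧ S.Infinite ∧
      (∀ i, κ ≤ ‖f i x‖ → i ∈ E) ∧ Submodule.span 𝕜 (e '' E) ≤ F ∧ x ∈ F ∧
      (∀ i ∈ B, e i ∈ F) ∧ (∀ i ∈ S, ‖f i x‖ < δ) ∧ (∀ i ∈ S, i ∉ B) ∧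
      ∀ u ∈ F, ∀ D : Finset ℕ, (D : Set ℕ) ⊆ S → ∀ g : ℕ → 𝕜,
        ‖u‖ ≤ (M + η) * ‖u + ∑ i ∈ D, g i • e i‖ := by
  have hfin := hb.finite_setOf_le_norm_apply x hκ
  set E := hfin.toFinset
  set T : Set X := insert x (e '' E ∪ e '' B)
  have hT : T.Finite := ((E.finite_toSet.image e).union (B.finite_toSet.image e)).insert x
  have : FiniteDimensional 𝕜 (Submodule.span 𝕜 T) := FiniteDimensional.span_of_finite 𝕜 hT
  obtain ⟨S, hS, hsep⟩ := hM.exists_infinite_separated hb hη (Submodule.span 𝕜 T)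
  refine ⟨E, Submodule.span 𝕜 T, S \ ({i | δ ≤ ‖f i x‖} ∪ B), this,
    hS.sdiff ((hb.finite_setOf_le_norm_apply x hδ).union B.finite_toSet),
    fun i hi => hfin.mem_toFinset.2 hi,
    Submodule.span_mono fun v hv => Or.inr (Or.inl hv),
    Submodule.subset_span (Or.inl rfl),
    fun i hi => Submodule.subset_span (Or.inr (Or.inr ⟨i, hi, rfl⟩)),
    fun i hi => ?_, fun i hi hiB => hi.2 (Or.inr hiB),
    fun u hu D hD => hsep u hu D (hD.trans Set.sdiff_subset)⟩
  by_contra! h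
  exact hi.2 (Or.inl h)

/-- A bounded sequence in a finite dimensional subspace has two terms that are close together. -/
theorem exists_ne_norm_sub_lt (F : Submodule 𝕜 X) [FiniteDimensional 𝕜 F] {y : ℕ → X}
    (hy : ∀ n, y n ∈ F) {R : ℝ} (hR : ∀ n, ‖y n‖ ≤ R) {η : ℝ} (hη : 0 < η) :
    ∃ p q, p ≠ q ∧ ‖y p - y q‖ < η := by
  have : ProperSpace F := FiniteDimensional.proper_rclike 𝕜 F
  obtain ⟨_, -, φ, hφ, hlim⟩ := (isCompact_closedBall (0 : F) R).tendsto_subseq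
    (x := fun n => (⟨y n, hy n⟩ : F)) fun n => by simpa using hR n
  obtain ⟨N, hN⟩ := Metric.cauchySeq_iff.1 hlim.cauchySeq η hη
  refine ⟨φ N, φ (N + 1), (hφ N.lt_succ_self).ne, ?_⟩
  simpa [Subtype.dist_eq, dist_eq_norm] using hN N le_rfl (N + 1) N.le_succ

/-- The limiting argument removing the small parameter. -/
theorem le_of_forall_small {u C w M : ℝ} (hs0 : 0 < s) (φ : ℝ → ℝ) (hφ : Continuous φ)
    (h : ∀ η : ℝ, 0 < η → η < 1 →
      (1 - η) * (s * u) ≤ (M + η) * (C * ((1 + η) / s * φ η)))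
    (h0 : M * (C * φ 0) * s⁻¹ ^ 2 = w) : u ≤ w := by
  have h1 : (1 - 0) * (s * u) ≤ (M + 0) * (C * ((1 + 0) / s * φ 0)) := by
    refine le_of_tendsto_of_tendsto (b := nhdsWithin (0 : ℝ) (Set.Ioi 0))
      (f := fun η : ℝ => (1 - η) * (s * u))
      (g := fun η : ℝ => (M + η) * (C * ((1 + η) / s * φ η))) ?_ ?_ ?_
    · exact (Continuous.tendsto (by fun_prop) 0).mono_left nhdsWithin_le_nhds
    · exact (Continuous.tendsto (by fun_prop) 0).mono_left nhdsWithin_le_nhds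
    · filter_upwards [Ioo_mem_nhdsGT (zero_lt_one' ℝ)] with η hη using h η hη.1 hη.2
  have h2 : M * (C * φ 0) * s⁻¹ ^ 2 = s⁻¹ * ((M + 0) * (C * ((1 + 0) / s * φ 0))) := by
    field_simp
    ring
  rw [← h0, h2, ← mul_le_mul_iff_right₀ hs0, mul_inv_cancel_left₀ hs0.ne']
  linarith

theorem HasGreedyApprox.mul_norm_sum_le (hb : IsMarkushevichBasis e f)
    (hM : FDSP (𝕜 := 𝕜) e M) (hG : HasGreedyApprox f m s L) (hL : 0 < L) (hs0 : 0 < s)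
    (hs1 : s ≤ 1) {x : X} {a : ℝ} {A B : Finset ℕ} (hAm : A.card = m)
    (hA : ∀ i ∈ A, a ≤ ‖f i x‖) (hBm : B.card = m) {ε : ℕ → 𝕜} (hε : ∀ i ∈ B, ‖ε i‖ = 1) :
    a * ‖∑ i ∈ B, ε i • e i‖ ≤ L ^ 2 * M * (1 + M) * s⁻¹ ^ 2 * ‖x‖ := by
  have hM0 := hM.nonneg hb
  rcases le_or_gt a 0 with ha | ha
  · exact (mul_nonpos_of_nonpos_of_nonneg ha (norm_nonneg _)).trans (by positivity)
  refine le_of_forall_small hs0 (M := M) (C := L) (fun η => (1 + M + η) * (L * ‖x‖))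
    (by fun_prop) (fun η hη hη1 => ?_) (by ring)
  have hsa : 0 < s * a := mul_pos hs0 ha
  obtain ⟨E, F, S, -, hS, hE, hEF, hxF, hBF, hSx, hSB, hsep⟩ :=
    exists_separated_indices hb hM hη (mul_pos hη hsa) hsa x B
  obtain ⟨D, hDS, hDm⟩ := hS.exists_subset_card_eq m
  obtain ⟨y, hy, hyx⟩ := hG.exists_norm_sub_add_le hb hs0 hs1 ha.le (b := (1 - η) * (s * a))
    (mul_nonneg (by linarith) hsa.le) (D := D) hAm hDm.le hA hE
    fun i hi => by linarith [hSx i (hDS hi)]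
  have hB : ∑ i ∈ B, ε i • e i ∈ F := F.sum_mem fun i hi => F.smul_mem _ (hBF i hi)
  have h1 := hG.norm_sum_le_of_separated hb (M' := M + η) (c := (1 + η) / s) (by linarith)
    (by positivity) (by rw [mul_div_cancel₀ _ hs0.ne']; linarith) hBm.le hDm
    (Finset.disjoint_right.2 fun i hi => hSB i (hDS hi)) hε (ε' := fun _ => 1) (by simp)
    (hsep _ hB D hDS)
  have h2 := hsep (x - y) (F.sub_mem hxF (hEF hy)) D hDS fun _ => (((1 - η) * (s * a) : ℝ) : 𝕜)
  rw [← Finset.smul_sum] at h2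
  simp only [one_smul] at h1
  have h3 : (1 - η) * (s * a) * ‖∑ i ∈ D, e i‖ ≤ (1 + M + η) * (L * ‖x‖) := by
    have h4 := norm_sub_le (x - y + (((1 - η) * (s * a) : ℝ) : 𝕜) • ∑ i ∈ D, e i) (x - y)
    rw [add_sub_cancel_left, norm_smul, RCLike.norm_ofReal,
      abs_of_nonneg (mul_nonneg (by linarith) hsa.le)] at h4
    nlinarith [mul_le_mul_of_nonneg_left hyx (show 0 ≤ M + η by linarith)]
  have hb0 : 0 ≤ (1 - η) * (s * a) := mul_nonneg (by linarith) hsa.le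
  calc (1 - η) * (s * (a * ‖∑ i ∈ B, ε i • e i‖))
      = (1 - η) * (s * a) * ‖∑ i ∈ B, ε i • e i‖ := by ring
    _ ≤ (1 - η) * (s * a) * ((M + η) * (L * ((1 + η) / s * ‖∑ i ∈ D, e i‖))) := by gcongr
    _ = (M + η) * (L * ((1 + η) / s * ((1 - η) * (s * a) * ‖∑ i ∈ D, e i‖))) := by ring
    _ ≤ _ := by gcongr

/-- For even `m`, two far sets of `m / 2` indices can be chosen so that the corresponding
approximants nearly agree; subtracting them improves the constant. -/
theorem HasGreedyApprox.mul_norm_sum_le_of_even (hb : IsMarkushevichBasis e f)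
    (hM : FDSP (𝕜 := 𝕜) e M) (hG : HasGreedyApprox f m s L) (hL : 0 < L) (hs0 : 0 < s)
    (hs1 : s ≤ 1) (hm : Even m) {x : X} {a : ℝ} {A B : Finset ℕ} (hAm : A.card = m)
    (hA : ∀ i ∈ A, a ≤ ‖f i x‖) (hBm : B.card = m) {ε : ℕ → 𝕜} (hε : ∀ i ∈ B, ‖ε i‖ = 1) :
    a * ‖∑ i ∈ B, ε i • e i‖ ≤ 2 * L ^ 2 * M * s⁻¹ ^ 2 * ‖x‖ := by
  have hM0 := hM.nonneg hb
  rcases le_or_gt a 0 with ha | ha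
  · exact (mul_nonpos_of_nonpos_of_nonneg ha (norm_nonneg _)).trans (by positivity)
  refine le_of_forall_small hs0 (M := M) (C := L) (fun η => 2 * (L * ‖x‖) + η)
    (by fun_prop) (fun η hη hη1 => ?_) (by ring)
  have hsa : 0 < s * a := mul_pos hs0 ha
  have hb0 : 0 ≤ (1 - η) * (s * a) := mul_nonneg (by linarith) hsa.le
  obtain ⟨h, rfl⟩ := hm
  obtain ⟨E, F, S, _, hS, hE, hEF, hxF, hBF, hSx, hSB, hsep⟩ :=
    exists_separated_indices hb hM hη (mul_pos hη hsa) hsa x B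
  set φ : ℕ ↪ ℕ := (hS.natEmbedding S).trans (Function.Embedding.subtype _)
  set D : ℕ → Finset ℕ := fun n => (Finset.Ico (n * h) ((n + 1) * h)).map φ with hD
  have hDS : ∀ n, (D n : Set ℕ) ⊆ S := by
    intro n i hi
    obtain ⟨j, -, rfl⟩ := Finset.mem_map.1 (Finset.mem_coe.1 hi)
    exact (hS.natEmbedding S j).2
  have hDcard : ∀ n, (D n).card = h := fun n => by
    rw [hD, Finset.card_map, Nat.card_Ico, add_mul, one_mul, Nat.add_sub_cancel_left]
  have hDdisj : ∀ p q, p ≠ q → Disjoint (D p) (D q) := by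
    intro p q hpq
    rw [Finset.disjoint_map, Finset.disjoint_left]
    intro i hi hi'
    rw [Finset.mem_Ico] at hi hi'
    rcases lt_or_gt_of_ne hpq with hlt | hlt
    · exact absurd (Nat.mul_le_mul_right h (Nat.succ_le_of_lt hlt)) (by
        rw [Nat.succ_eq_add_one]; omega)
    · exact absurd (Nat.mul_le_mul_right h (Nat.succ_le_of_lt hlt)) (by
        rw [Nat.succ_eq_add_one]; omega)
  choose y hy hyx using fun n => hG.exists_norm_sub_add_le hb hs0 hs1 ha.le hb0 (D := D n) hAm
    (by rw [hDcard]; omega) hA hE fun i hi => by linarith [hSx i (hDS n hi)]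
  obtain ⟨p, q, hpq, hypq⟩ := exists_ne_norm_sub_lt F (fun n => hEF (hy n))
    (R := ‖x‖ + (M + η) * (L * ‖x‖)) (fun n => by
      have h2 := hsep (x - y n) (F.sub_mem hxF (hEF (hy n))) (D n) (hDS n)
        fun _ => (((1 - η) * (s * a) : ℝ) : 𝕜)
      rw [← Finset.smul_sum] at h2
      have h3 := norm_sub_le x (x - y n)
      rw [sub_sub_cancel] at h3
      nlinarith [mul_le_mul_of_nonneg_left (hyx n) (show 0 ≤ M + η by linarith)]) hη
  have hB : ∑ i ∈ B, ε i • e i ∈ F := F.sum_mem fun i hi => F.smul_mem _ (hBF i hi)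
  have hDpq : ((D p ∪ D q : Finset ℕ) : Set ℕ) ⊆ S := by
    rw [Finset.coe_union]
    exact Set.union_subset (hDS p) (hDS q)
  have h1 := hG.norm_sum_le_of_separated hb (M' := M + η) (c := (1 + η) / s) (D := D p ∪ D q)
    (by linarith) (by positivity) (by rw [mul_div_cancel₀ _ hs0.ne']; linarith) hBm.le
    (by rw [Finset.card_union_of_disjoint (hDdisj p q hpq), hDcard, hDcard])
    (Finset.disjoint_right.2 fun i hi => hSB i (hDpq hi)) hε
    (ε' := fun i => if i ∈ D p then 1 else -1) (by intro i _; split_ifs <;> simp)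
    (hsep _ hB _ hDpq)
  have hsum : ∑ i ∈ D p ∪ D q, (if i ∈ D p then (1 : 𝕜) else -1) • e i =
      ∑ i ∈ D p, e i - ∑ i ∈ D q, e i := by
    rw [Finset.sum_union (hDdisj p q hpq), sub_eq_add_neg, ← Finset.sum_neg_distrib]
    congr 1
    · exact Finset.sum_congr rfl fun i hi => by rw [if_pos hi, one_smul]
    · exact Finset.sum_congr rfl fun i hi => by
        rw [if_neg (Finset.disjoint_right.1 (hDdisj p q hpq) hi), neg_one_smul]
  rw [hsum] at h1
  have h3 : (1 - η) * (s * a) * ‖∑ i ∈ D p, e i - ∑ i ∈ D q, e i‖ ≤ 2 * (L * ‖x‖) + η := by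
    set β : 𝕜 := (((1 - η) * (s * a) : ℝ) : 𝕜) with hβ
    have hβn : ‖β‖ = (1 - η) * (s * a) := by
      rw [hβ, RCLike.norm_ofReal, abs_of_nonneg hb0]
    have hid : β • (∑ i ∈ D p, e i - ∑ i ∈ D q, e i) =
        (x - y p + β • ∑ i ∈ D p, e i) - (x - y q + β • ∑ i ∈ D q, e i) + (y p - y q) := by
      rw [smul_sub]; abel
    rw [← hβn, ← norm_smul, hid]
    refine (norm_add_le _ _).trans ?_
    linarith [norm_sub_le (x - y p + β • ∑ i ∈ D p, e i) (x - y q + β • ∑ i ∈ D q, e i),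
      hyx p, hyx q]
  calc (1 - η) * (s * (a * ‖∑ i ∈ B, ε i • e i‖))
      = (1 - η) * (s * a) * ‖∑ i ∈ B, ε i • e i‖ := by ring
    _ ≤ (1 - η) * (s * a) *
        ((M + η) * (L * ((1 + η) / s * ‖∑ i ∈ D p, e i - ∑ i ∈ D q, e i‖))) := by gcongr
    _ = (M + η) * (L * ((1 + η) / s *
        ((1 - η) * (s * a) * ‖∑ i ∈ D p, e i - ∑ i ∈ D q, e i‖))) := by ring
    _ ≤ _ := by gcongr

theorem IsMarkushevichBasis.mul_norm_smul_le (hb : IsMarkushevichBasis e f) {x : X} {a : ℝ}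
    {i j : ℕ} (ha : a ≤ ‖f i x‖) {c : 𝕜} (hc : ‖c‖ = 1) :
    a * ‖c • e j‖ ≤ (⨆ i, ‖e i‖) * (⨆ i, ‖f i‖) * ‖x‖ := by
  rw [norm_smul, hc, one_mul, mul_comm, mul_assoc]
  have h1 : ‖e j‖ ≤ ⨆ i, ‖e i‖ := le_ciSup hb.bddE j
  have h2 := ha.trans (hb.norm_apply_le i x)
  have h3 : 0 ≤ (⨆ i, ‖f i‖) * ‖x‖ := (norm_nonneg _).trans (hb.norm_apply_le i x)
  exact (mul_le_mul_of_nonneg_left h2 (norm_nonneg _)).trans (mul_le_mul_of_nonneg_right h1 h3)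

/-- bounds for the squeeze symmetry parameter. -/
theorem statement11 {𝕜 : Type*} [RCLike 𝕜] {X : Type*} [NormedAddCommGroup X]
    [NormedSpace 𝕜 X] [CompleteSpace X]
    (e : ℕ → X) (f : ℕ → X →L[𝕜] 𝕜) (hbasis : IsMarkushevichBasis e f)
    (M : ℝ) (hfdsp : FDSP (𝕜 := 𝕜) e M)
    (s : ℝ) (hs0 : 0 < s) (hs1 : s ≤ 1)
    (m : ℕ) (L : ℝ) (hL : 0 < L)
    (happrox : ∀ x : X, ∃ A : Finset ℕ, GreedySet f x m s A ∧
      ∃ y : X, msupp f y ⊆ (A : Set ℕ) ∧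
        ∀ z : X, (msupp f z).Finite → (msupp f z).ncard ≤ m → ‖x - y‖ ≤ L * ‖x - z‖) :
    (∀ (x : X) (A : Finset ℕ) (hA : A.Nonempty), GreedySet f x m 1 A →
      ∀ B : Finset ℕ, B.card = m → ∀ ε : ℕ → 𝕜, (∀ i ∈ B, ‖ε i‖ = 1) →
        (A.inf' hA fun i => ‖f i x‖) * ‖∑ i ∈ B, ε i • e i‖ ≤
          L ^ 2 * M * (1 + M) * s⁻¹ ^ 2 * ‖x‖) ∧
    (Even m →
      ∀ (x : X) (A : Finset ℕ) (hA : A.Nonempty), GreedySet f x m 1 A →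
        ∀ B : Finset ℕ, B.card = m → ∀ ε : ℕ → 𝕜, (∀ i ∈ B, ‖ε i‖ = 1) →
          (A.inf' hA fun i => ‖f i x‖) * ‖∑ i ∈ B, ε i • e i‖ ≤
            2 * L ^ 2 * M * s⁻¹ ^ 2 * ‖x‖) ∧
    (Odd m → 1 < m → ∀ L' : ℝ, 0 < L' →
      (∀ x : X, ∃ A : Finset ℕ, GreedySet f x (m - 1) s A ∧
        ∃ y : X, msupp f y ⊆ (A : Set ℕ) ∧
          ∀ z : X, (msupp f z).Finite → (msupp f z).ncard ≤ m - 1 → ‖x - y‖ ≤ L' * ‖x - z‖) →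
      ∀ (x : X) (A : Finset ℕ) (hA : A.Nonempty), GreedySet f x m 1 A →
        ∀ B : Finset ℕ, B.card = m → ∀ ε : ℕ → 𝕜, (∀ i ∈ B, ‖ε i‖ = 1) →
          (A.inf' hA fun i => ‖f i x‖) * ‖∑ i ∈ B, ε i • e i‖ ≤
            (2 * L' ^ 2 * M * s⁻¹ ^ 2 + (⨆ i, ‖e i‖) * (⨆ i, ‖f i‖)) * ‖x‖) ∧
    (m = 1 →
      ∀ (x : X) (A : Finset ℕ) (hA : A.Nonempty), GreedySet f x m 1 A →
        ∀ B : Finset ℕ, B.card = m → ∀ ε : ℕ → 𝕜, (∀ i ∈ B, ‖ε i‖ = 1) →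
          (A.inf' hA fun i => ‖f i x‖) * ‖∑ i ∈ B, ε i • e i‖ ≤
            ((⨆ i, ‖e i‖) * (⨆ i, ‖f i‖)) * ‖x‖) := by
  have hinf : ∀ (x : X) (A : Finset ℕ) (hA : A.Nonempty), ∀ i ∈ A,
      (A.inf' hA fun i => ‖f i x‖) ≤ ‖f i x‖ := fun x A hA i hi => Finset.inf'_le _ hi
  have hG : HasGreedyApprox f m s L := happrox
  refine ⟨fun x A hA hAx B hB ε hε => ?_, fun hm x A hA hAx B hB ε hε => ?_,
    fun hm hm1 L' hL' hG' x A hA hAx B hB ε hε => ?_, fun hm x A hA hAx B hB ε hε => ?_⟩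
  · exact hG.mul_norm_sum_le hbasis hfdsp hL hs0 hs1 hAx.1 (hinf x A hA) hB hε
  · exact hG.mul_norm_sum_le_of_even hbasis hfdsp hL hs0 hs1 hm hAx.1 (hinf x A hA) hB hε
  · obtain ⟨i, hi⟩ := hA
    obtain ⟨j, hj⟩ : B.Nonempty := Finset.card_pos.1 (by omega)
    have hG'' : HasGreedyApprox f (m - 1) s L' := hG'
    have h1 := hG''.mul_norm_sum_le_of_even hbasis hfdsp hL' hs0 hs1 (Nat.Odd.sub_odd hm odd_one)
      (by rw [Finset.card_erase_of_mem hi, hAx.1])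
      (fun n hn => hinf x A ⟨i, hi⟩ n (Finset.mem_of_mem_erase hn))
      (by rw [Finset.card_erase_of_mem hj, hB])
      (fun n hn => hε n (Finset.mem_of_mem_erase hn))
    have h2 := hbasis.mul_norm_smul_le (j := j) (hinf x A ⟨i, hi⟩ i hi) (hε j hj)
    have ha : 0 ≤ A.inf' ⟨i, hi⟩ fun i => ‖f i x‖ :=
      Finset.le_inf' _ _ fun _ _ => norm_nonneg _
    rw [← Finset.sum_erase_add B _ hj, add_mul]
    refine (mul_le_mul_of_nonneg_left (norm_add_le _ _) ha).trans ?_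
    rw [mul_add]
    exact add_le_add h1 h2
  · obtain ⟨j, rfl⟩ := Finset.card_eq_one.1 (hB.trans hm)
    obtain ⟨i, hi⟩ := hA
    rw [Finset.sum_singleton]
    exact hbasis.mul_norm_smul_le (hinf x A ⟨i, hi⟩ i hi) (hε j (by simp))

end GreedyPaper
end
end

section
/- Let ℬ be a Markushevich basis of 𝕏, w a weight, C > 0 and 0 < s ≤ 1. Suppose that for every x ∈ 𝕏 with finite support and every m ∈ ℕ there exist A ∈ 𝒢(x,m,s) and y ∈ 𝕏 with supp(y) ⊆ A such that ‖x − y‖ ≤ C·inf{‖x − z‖ : z ∈ 𝕏, supp(z) finite, w(supp(z)) ≤ w(A)}. Then ℬ is C-s-w-semi-greedy; moreover, for every x ∈ 𝕏 and m ∈ ℕ there exist A ∈ 𝒢(x,m,s) and y ∈ 𝕏 with supp(y) ⊆ A such that ‖x − y‖ ≤ C·inf{‖x − z‖ : z ∈ 𝕏, w(supp(z)) ≤ w(A)}, with no finiteness restriction on supp(z). -/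
open scoped BigOperators ENNReal
open Filter

noncomputable section

namespace GreedyPaper

variable {𝕜 : Type*} [RCLike 𝕜] {X : Type*} [NormedAddCommGroup X] [NormedSpace 𝕜 X]

section Auxiliary

variable {e : ℕ → X} {f : ℕ → X →L[𝕜] 𝕜}

lemma wsum_mono (w : ℕ → ℝ) {S T : Set ℕ} (h : S ⊆ T) : wsum w S ≤ wsum w T :=
  ENNReal.tsum_mono_subtype (fun i => ENNReal.ofReal (w i)) h

lemma wsum_finset_ne_top (w : ℕ → ℝ) (A : Finset ℕ) : wsum w (A : Set ℕ) ≠ ∞ := by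
  have h : wsum w (A : Set ℕ) = ∑ i ∈ A, ENNReal.ofReal (w i) :=
    Finset.tsum_subtype' A (fun i => ENNReal.ofReal (w i))
  rw [h]
  exact ENNReal.sum_ne_top.2 fun i _ => ENNReal.ofReal_ne_top

lemma IsMarkushevichBasis.apply_sum_s17 (hb : IsMarkushevichBasis e f) (t : Finset ℕ) (a : ℕ → 𝕜)
    (k : ℕ) : f k (∑ i ∈ t, a i • e i) = if k ∈ t then a k else 0 := by
  simp [map_sum, hb.biorth]

lemma IsMarkushevichBasis.msupp_sum_subset_s17 (hb : IsMarkushevichBasis e f) (t : Finset ℕ)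
    (a : ℕ → 𝕜) : msupp f (∑ i ∈ t, a i • e i) ⊆ (t : Set ℕ) := by
  intro k hk
  by_contra hkt
  exact hk (by rw [hb.apply_sum_s17, if_neg (by simpa using hkt)])

lemma IsMarkushevichBasis.eq_of_apply_eq (hb : IsMarkushevichBasis e f) {x y : X}
    (h : ∀ i, f i x = f i y) : x = y :=
  sub_eq_zero.1 (hb.total _ fun i => by rw [map_sub, h, sub_self])

lemma IsMarkushevichBasis.eq_sum_of_msupp_subset_s17 (hb : IsMarkushevichBasis e f) {y : X}
    {A : Finset ℕ} (hy : msupp f y ⊆ (A : Set ℕ)) : y = ∑ i ∈ A, f i y • e i := by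
  refine hb.eq_of_apply_eq fun k => ?_
  rw [hb.apply_sum_s17]
  split_ifs with hk
  · rfl
  · by_contra h
    exact hk (hy h)

lemma IsMarkushevichBasis.exists_norm_apply_le (hb : IsMarkushevichBasis e f) :
    ∃ M : ℝ, 0 < M ∧ ∀ i x, ‖f i x‖ ≤ M * ‖x‖ := by
  obtain ⟨M, hM⟩ := hb.bddF
  refine ⟨max M 1, by positivity, fun i x => ((f i).le_opNorm x).trans ?_⟩
  gcongr
  exact (hM ⟨i, rfl⟩).trans (le_max_left _ _)

/-- Finitely supported vectors are dense. -/
lemma IsMarkushevichBasis.dense_finite_msupp (hb : IsMarkushevichBasis e f) :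
    Dense {x : X | (msupp f x).Finite} := by
  refine hb.dense_span.mono fun x hx => ?_
  change x ∈ Submodule.span 𝕜 (Set.range e) at hx
  obtain ⟨c, rfl⟩ := (Finsupp.mem_span_range_iff_exists_finsupp).1 hx
  exact (Finset.finite_toSet _).subset (hb.msupp_sum_subset_s17 c.support c)

/-- The coefficients of a vector tend to zero. -/
lemma IsMarkushevichBasis.finite_le_norm_apply (hb : IsMarkushevichBasis e f) (x : X) {η : ℝ}
    (hη : 0 < η) : {i | η ≤ ‖f i x‖}.Finite := by
  obtain ⟨M, hM0, hM⟩ := hb.exists_norm_apply_le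
  obtain ⟨x', hx', hd⟩ := hb.dense_finite_msupp.exists_dist_lt x (div_pos hη hM0)
  refine Set.Finite.subset hx' fun i hi h0 => ?_
  have h1 := hM i (x - x')
  rw [map_sub, h0, sub_zero] at h1
  rw [dist_eq_norm, lt_div_iff₀ hM0] at hd
  have hi' : η ≤ ‖f i x‖ := hi
  linarith

/-- The semi-greedy condition at the vector `x`. -/
def SemiGreedyAt (f : ℕ → X →L[𝕜] 𝕜) (w : ℕ → ℝ) (C s : ℝ) (x : X) (m : ℕ) (A : Finset ℕ)
    (y : X) : Prop :=
  GreedySet f x m s A ∧ msupp f y ⊆ (A : Set ℕ) ∧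
    ∀ z : X, (msupp f z).Finite → wsum w (msupp f z) ≤ wsum w (A : Set ℕ) →
      ‖x - y‖ ≤ C * ‖x - z‖

variable {w : ℕ → ℝ} {C s : ℝ}

/-- Vectors whose support has weight at most `w 0` satisfy an upper `c₀`-estimate. -/
lemma IsMarkushevichBasis.norm_sum_le (hb : IsMarkushevichBasis e f) (hs0 : 0 < s)
    (hfin : ∀ x : X, (msupp f x).Finite → ∀ m : ℕ, ∃ A y, SemiGreedyAt f w C s x m A y)
    {t : Finset ℕ} (h0 : 0 ∉ t) (a : ℕ → 𝕜) {r : ℝ} (hr : 0 < r) (ha : ∀ i ∈ t, ‖a i‖ ≤ r)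
    (hwt : wsum w (msupp f (∑ i ∈ t, a i • e i)) ≤ wsum w {0}) :
    ‖∑ i ∈ t, a i • e i‖ ≤ (1 + ‖f 0‖ * ‖e 0‖) * (C * (2 / s * ‖e 0‖)) * r := by
  set v := ∑ i ∈ t, a i • e i with hv
  have hfv : ∀ k, f k v = if k ∈ t then a k else 0 := hb.apply_sum_s17 t a
  set b : ℝ := 2 * r / s with hbdef
  have hb0 : 0 < b := by positivity
  have hvfin : (msupp f v).Finite := (Finset.finite_toSet t).subset (hb.msupp_sum_subset_s17 t a)
  set x : X := v + (b : 𝕜) • e 0 with hx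
  have hfx : ∀ k, f k x = f k v + if k = 0 then (b : 𝕜) else 0 := by
    intro k
    simp [hx, hb.biorth]
  have hxfin : (msupp f x).Finite := by
    refine (hvfin.insert 0).subset fun k hk => ?_
    by_contra hk'
    simp only [Set.mem_insert_iff, not_or] at hk'
    refine hk ?_
    rw [hfx, if_neg hk'.1, add_zero]
    exact not_not.1 hk'.2
  obtain ⟨A, y, ⟨hcard, hgr⟩, hyA, hz⟩ := hfin x hxfin 1
  obtain ⟨j, rfl⟩ := Finset.card_eq_one.1 hcard
  have hj : j = 0 := by
    by_contra hj
    have h1 := hgr j (by simp) 0 (by simpa using Ne.symm hj)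
    have h2 : ‖f j v‖ ≤ r := by
      rw [hfv]
      split_ifs with hjt
      · exact ha j hjt
      · simpa using hr.le
    rw [hfx, hfx, if_neg hj, add_zero, hfv 0, if_neg h0, if_pos rfl, zero_add,
      RCLike.norm_ofReal, abs_of_pos hb0, hbdef, mul_div_cancel₀ _ hs0.ne'] at h1
    linarith
  subst hj
  have hxy : ‖x - y‖ ≤ C * (2 / s * ‖e 0‖) * r := by
    have h := hz v hvfin (by simpa using hwt)
    rw [hx, add_sub_cancel_left, norm_smul, RCLike.norm_ofReal, abs_of_pos hb0] at h
    rw [hx]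
    refine h.trans_eq ?_
    rw [hbdef]
    ring
  have hveq : v = (x - y) - f 0 (x - y) • e 0 := by
    have hy := hb.eq_sum_of_msupp_subset_s17 hyA
    rw [Finset.sum_singleton] at hy
    have h3 : f 0 x = b := by rw [hfx, hfv, if_neg h0, if_pos rfl, zero_add]
    rw [map_sub, h3, sub_smul, ← hy, hx]
    abel
  have h4 : ‖f 0 (x - y) • e 0‖ ≤ ‖f 0‖ * ‖e 0‖ * ‖x - y‖ := by
    rw [norm_smul]
    calc ‖f 0 (x - y)‖ * ‖e 0‖ ≤ ‖f 0‖ * ‖x - y‖ * ‖e 0‖ := by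
          gcongr
          exact (f 0).le_opNorm _
      _ = _ := by ring
  calc ‖v‖ ≤ ‖x - y‖ + ‖f 0 (x - y) • e 0‖ := by
        conv_lhs => rw [hveq]
        exact norm_sub_le _ _
    _ ≤ (1 + ‖f 0‖ * ‖e 0‖) * ‖x - y‖ := by linarith
    _ ≤ (1 + ‖f 0‖ * ‖e 0‖) * (C * (2 / s * ‖e 0‖) * r) := by gcongr
    _ = _ := by ring

/-- A vector whose support has finite weight is the unconditional sum of its expansion. -/
lemma IsMarkushevichBasis.hasSum_of_wsum_ne_top [CompleteSpace X] (hb : IsMarkushevichBasis e f)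
    (hw : ∀ i, 0 < w i) (hC : 0 < C) (hs0 : 0 < s)
    (hfin : ∀ x : X, (msupp f x).Finite → ∀ m : ℕ, ∃ A y, SemiGreedyAt f w C s x m A y)
    {z : X} (hz : wsum w (msupp f z) ≠ ∞) : HasSum (fun i => f i z • e i) z := by
  classical
  have hsummable : Summable (fun i => f i z • e i) := by
    rw [summable_iff_vanishing_norm]
    intro ε hε
    set K : ℝ := (1 + ‖f 0‖ * ‖e 0‖) * (C * (2 / s * ‖e 0‖)) with hK
    have hK0 : 0 ≤ K := by positivity
    have hη : 0 < ε / (K + 1) := by positivity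
    set g : ℕ → ℝ≥0∞ := (msupp f z).indicator fun i => ENNReal.ofReal (w i) with hg
    have hgtop : ∑' i, g i ≠ ∞ := by
      rw [hg, ← tsum_subtype]
      exact hz
    have hw0 : 0 < wsum w {0} := by
      rw [wsum, tsum_singleton 0 (fun i => ENNReal.ofReal (w i))]
      exact ENNReal.ofReal_pos.2 (hw 0)
    obtain ⟨F, hF⟩ := ((ENNReal.tendsto_tsum_compl_atTop_zero hgtop).eventually
      (gt_mem_nhds hw0)).exists
    refine ⟨F ∪ {0} ∪ (hb.finite_le_norm_apply z hη).toFinset, fun t ht => ?_⟩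
    simp only [Finset.disjoint_union_right, Finset.disjoint_singleton_right] at ht
    obtain ⟨⟨htF, ht0⟩, htη⟩ := ht
    refine (hb.norm_sum_le hs0 hfin ht0 (fun i => f i z) hη (fun i hi => ?_) ?_).trans_lt ?_
    · have := Finset.disjoint_left.1 htη hi
      simp only [Set.Finite.mem_toFinset, Set.mem_ofPred_eq, not_le] at this
      exact this.le
    · refine le_trans ?_ hF.le
      set S := msupp f (∑ i ∈ t, f i z • e i) with hS
      have hSz : S ⊆ msupp f z := by
        intro k hk h0
        refine hk ?_
        rw [hb.apply_sum_s17]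
        split_ifs
        · exact h0
        · rfl
      have hSF : S ⊆ {k | k ∉ F} := fun k hk =>
        Finset.disjoint_left.1 htF (by simpa using hb.msupp_sum_subset_s17 t _ hk)
      calc wsum w S = ∑' i : S, g i := by
            refine tsum_congr fun i => ?_
            rw [hg, Set.indicator_of_mem (hSz i.2)]
        _ ≤ _ := ENNReal.tsum_mono_subtype g hSF
    · change K * (ε / (K + 1)) < ε
      rw [mul_div_assoc', div_lt_iff₀ (by positivity)]
      nlinarith
  obtain ⟨z', hz'⟩ := hsummable
  have : z' = z := by
    refine hb.eq_of_apply_eq fun k => ?_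
    have h1 : HasSum (fun i => f k (f i z • e i)) (f k z') := (f k).hasSum hz'
    refine h1.unique ?_
    have h2 := hasSum_single (f := fun i => f k (f i z • e i)) k fun i hi => by
      simp [hb.biorth, hi.symm]
    simpa [hb.biorth] using h2
  exact this ▸ hz'

/-- The semi-greedy estimate extends to competitors of infinite support. -/
lemma SemiGreedyAt.norm_sub_le [CompleteSpace X] (hb : IsMarkushevichBasis e f)
    (hw : ∀ i, 0 < w i) (hC : 0 < C) (hs0 : 0 < s)
    (hfin : ∀ x : X, (msupp f x).Finite → ∀ m : ℕ, ∃ A y, SemiGreedyAt f w C s x m A y)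
    {x y : X} {m : ℕ} {A : Finset ℕ} (h : SemiGreedyAt f w C s x m A y) (z : X)
    (hz : wsum w (msupp f z) ≤ wsum w (A : Set ℕ)) : ‖x - y‖ ≤ C * ‖x - z‖ := by
  have hsum := hb.hasSum_of_wsum_ne_top hw hC hs0 hfin
    (ne_top_of_le_ne_top (wsum_finset_ne_top w A) hz)
  have hlim : Tendsto (fun F : Finset ℕ => C * ‖x - ∑ i ∈ F, f i z • e i‖) atTop
      (nhds (C * ‖x - z‖)) := (tendsto_const_nhds.sub hsum).norm.const_mul C
  refine ge_of_tendsto' hlim fun F => h.2.2 _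
    ((Finset.finite_toSet F).subset (hb.msupp_sum_subset_s17 F _)) ((wsum_mono w ?_).trans hz)
  intro k hk h0
  refine hk ?_
  rw [hb.apply_sum_s17]
  split_ifs
  · exact h0
  · rfl

/-- The greedy sets of vectors close to a vector of infinite support lie in a fixed finite set. -/
lemma IsMarkushevichBasis.eventually_greedySet_subset (hb : IsMarkushevichBasis e f)
    (hs0 : 0 < s) (hs1 : s ≤ 1) {x : X} (hx : (msupp f x).Infinite) (m : ℕ) :
    ∃ T : Finset ℕ, ∀ᶠ x' in nhds x, ∀ A, GreedySet f x' m s A → A ⊆ T := by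
  obtain ⟨S, hSx, hSm⟩ := hx.exists_subset_card_eq m
  obtain ⟨a, ha0, ha⟩ : ∃ a : ℝ, 0 < a ∧ ∀ i ∈ S, a ≤ ‖f i x‖ := by
    rcases S.eq_empty_or_nonempty with rfl | hS
    · exact ⟨1, one_pos, by simp⟩
    · obtain ⟨i, hi, hmin⟩ := S.exists_min_image (fun i => ‖f i x‖) hS
      exact ⟨‖f i x‖, norm_pos_iff.2 (hSx hi), hmin⟩
  obtain ⟨M, hM0, hM⟩ := hb.exists_norm_apply_le
  have hη : 0 < s * a / 4 := by positivity
  refine ⟨(hb.finite_le_norm_apply x (η := s * a / 2) (by positivity)).toFinset, ?_⟩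
  filter_upwards [Metric.ball_mem_nhds x (div_pos hη hM0)] with x' hx' A hA j hj
  have hclose : ∀ i, |‖f i x'‖ - ‖f i x‖| ≤ s * a / 4 := fun i => by
    refine (abs_norm_sub_norm_le _ _).trans ?_
    rw [← map_sub]
    refine (hM i _).trans ?_
    rw [Metric.mem_ball, dist_eq_norm, lt_div_iff₀ hM0] at hx'
    linarith
  have hjx' : s * (a - s * a / 4) ≤ ‖f j x'‖ := by
    obtain ⟨k, hkS, hkj⟩ : ∃ k ∈ S, s * ‖f k x'‖ ≤ ‖f j x'‖ := by
      by_cases hSA : S ⊆ A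
      · have : S = A := Finset.eq_of_subset_of_card_le hSA (by rw [hA.1, hSm])
        exact ⟨j, this ▸ hj, mul_le_of_le_one_left (norm_nonneg _) hs1⟩
      · obtain ⟨k, hkS, hkA⟩ := Finset.not_subset.1 hSA
        exact ⟨k, hkS, hA.2 j hj k hkA⟩
    refine le_trans ?_ hkj
    have h1 := (abs_le.1 (hclose k)).1
    have h2 := ha k hkS
    gcongr
    linarith
  have h3 := (abs_le.1 (hclose j)).2
  have h4 : s * (s * a / 4) ≤ s * a / 4 := mul_le_of_le_one_left hη.le hs1
  simp only [Set.Finite.mem_toFinset, Set.mem_ofPred_eq]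
  linarith

/-- The semi-greedy condition passes from finitely supported vectors to all vectors. -/
lemma IsMarkushevichBasis.exists_semiGreedyAt (hb : IsMarkushevichBasis e f)
    (hC : 0 < C) (hs0 : 0 < s) (hs1 : s ≤ 1)
    (hfin : ∀ x : X, (msupp f x).Finite → ∀ m : ℕ, ∃ A y, SemiGreedyAt f w C s x m A y)
    (x : X) (m : ℕ) : ∃ A y, SemiGreedyAt f w C s x m A y := by
  classical
  by_cases hx : (msupp f x).Finite
  · exact hfin x hx m
  obtain ⟨T, hT⟩ := hb.eventually_greedySet_subset hs0 hs1 hx m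
  have hne : (nhdsWithin x {x | (msupp f x).Finite}).NeBot :=
    mem_closure_iff_nhdsWithin_neBot.1 (hb.dense_finite_msupp x)
  obtain ⟨u, hu⟩ := Ultrafilter.exists_le (nhdsWithin x {x | (msupp f x).Finite})
  have hux : Tendsto id (u : Filter X) (nhds x) := hu.trans inf_le_left
  have hufin : ∀ᶠ x' in (u : Filter X), (msupp f x').Finite := hu self_mem_nhdsWithin
  have hchoice : ∀ x' : X, ∃ p : Finset ℕ × X,
      (msupp f x').Finite → SemiGreedyAt f w C s x' m p.1 p.2 := fun x' => by
    by_cases h : (msupp f x').Finite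
    · obtain ⟨A, y, hAy⟩ := hfin x' h m
      exact ⟨(A, y), fun _ => hAy⟩
    · exact ⟨(∅, 0), fun h' => absurd h' h⟩
  choose p hp using hchoice
  obtain ⟨A, -, hA⟩ : ∃ A ∈ (T.powerset : Set (Finset ℕ)), ∀ᶠ x' in (u : Filter X),
      (p x').1 = A := by
    have hmem : ∀ᶠ x' in (u : Filter X), (p x').1 ∈ (T.powerset : Set (Finset ℕ)) := by
      filter_upwards [hufin, hux.eventually hT] with x' h1 h2
      simpa using h2 _ (hp x' h1).1
    exact (Ultrafilter.eventually_exists_mem_iff (Finset.finite_toSet _)).1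
      (hmem.mono fun x' h => ⟨_, h, rfl⟩)
  have hgood : ∀ᶠ x' in (u : Filter X), SemiGreedyAt f w C s x' m A (p x').2 := by
    filter_upwards [hufin, hA] with x' h1 h2
    exact h2 ▸ hp x' h1
  obtain ⟨M, hM0, hM⟩ := hb.exists_norm_apply_le
  have hcoef : ∀ i, ∃ c : 𝕜, Tendsto (fun x' => f i (p x').2) (u : Filter X) (nhds c) := by
    intro i
    have hbd : ∀ᶠ x' in (u : Filter X), f i (p x').2 ∈
        Metric.closedBall (0 : 𝕜) (M * ((1 + C) * (‖x‖ + 1))) := by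
      filter_upwards [hgood, hux.norm.eventually (gt_mem_nhds (lt_add_one ‖x‖))] with x' h1 h2
      rw [mem_closedBall_zero_iff]
      refine (hM i _).trans ?_
      gcongr
      have h3 := h1.2.2 0 (by simp [msupp]) (by simp [msupp, wsum])
      rw [sub_zero] at h3
      have h4 : ‖(p x').2‖ ≤ ‖x'‖ + ‖x' - (p x').2‖ := by
        simpa using norm_sub_le x' (x' - (p x').2)
      have h5 : ‖x'‖ ≤ ‖x‖ + 1 := h2.le
      nlinarith
    obtain ⟨c, -, hc⟩ := (isCompact_closedBall (0 : 𝕜) _).ultrafilter_le_nhds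
      (u.map fun x' => f i (p x').2) (le_principal_iff.2 hbd)
    exact ⟨c, hc⟩
  choose c hc using hcoef
  have hy : Tendsto (fun x' => (p x').2) (u : Filter X) (nhds (∑ i ∈ A, c i • e i)) := by
    refine Tendsto.congr' ?_ (tendsto_finsetSum A fun i _ => (hc i).smul_const (e i))
    filter_upwards [hgood] with x' h
    exact (hb.eq_sum_of_msupp_subset_s17 h.2.1).symm
  have hcont : ∀ i, Tendsto (fun x' => ‖f i x'‖) (u : Filter X) (nhds ‖f i x‖) := fun i =>
    (((f i).continuous.tendsto x).comp hux).norm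
  refine ⟨A, ∑ i ∈ A, c i • e i, ⟨?_, fun j hj k hk => ?_⟩, hb.msupp_sum_subset_s17 A c,
    fun z hz hzw => ?_⟩
  · obtain ⟨x', hx'⟩ := hgood.exists
    exact hx'.1.1
  · exact le_of_tendsto_of_tendsto ((hcont k).const_mul s) (hcont j)
      (hgood.mono fun x' h => h.1.2 j hj k hk)
  · exact le_of_tendsto_of_tendsto (hux.sub hy).norm
      ((hux.sub tendsto_const_nhds).norm.const_mul C)
      (hgood.mono fun x' h => h.2.2 z hz hzw)

end Auxiliary

/-- the semi-greedy condition for finitely supported vectors implies the full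
semi-greedy condition, even with no finiteness restriction on the competing vectors. -/
theorem statement17 {𝕜 : Type*} [RCLike 𝕜] {X : Type*} [NormedAddCommGroup X]
    [NormedSpace 𝕜 X] [CompleteSpace X]
    (e : ℕ → X) (f : ℕ → X →L[𝕜] 𝕜) (hbasis : IsMarkushevichBasis e f)
    (w : ℕ → ℝ) (hw : ∀ i, 0 < w i)
    (C s : ℝ) (hC : 0 < C) (hs0 : 0 < s) (hs1 : s ≤ 1)
    (hfin : ∀ x : X, (msupp f x).Finite → ∀ m : ℕ,
      ∃ A : Finset ℕ, GreedySet f x m s A ∧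
        ∃ y : X, msupp f y ⊆ (A : Set ℕ) ∧
          ∀ z : X, (msupp f z).Finite → wsum w (msupp f z) ≤ wsum w (A : Set ℕ) →
            ‖x - y‖ ≤ C * ‖x - z‖) :
    SemiGreedy e f w C s ∧
      ∀ (x : X) (m : ℕ), ∃ A : Finset ℕ, GreedySet f x m s A ∧
        ∃ y : X, msupp f y ⊆ (A : Set ℕ) ∧
          ∀ z : X, wsum w (msupp f z) ≤ wsum w (A : Set ℕ) → ‖x - y‖ ≤ C * ‖x - z‖ := by
  have hfin' : ∀ x : X, (msupp f x).Finite → ∀ m : ℕ, ∃ A y, SemiGreedyAt f w C s x m A y := by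
    intro x hx m
    obtain ⟨A, hA, y, hy, h⟩ := hfin x hx m
    exact ⟨A, y, hA, hy, h⟩
  have key : ∀ (x : X) (m : ℕ), ∃ A : Finset ℕ, GreedySet f x m s A ∧
      ∃ y : X, msupp f y ⊆ (A : Set ℕ) ∧
        ∀ z : X, wsum w (msupp f z) ≤ wsum w (A : Set ℕ) → ‖x - y‖ ≤ C * ‖x - z‖ := by
    intro x m
    obtain ⟨A, y, h⟩ := hbasis.exists_semiGreedyAt hC hs0 hs1 hfin' x m
    exact ⟨A, h.1, y, h.2.1, h.norm_sub_le hbasis hw hC hs0 hfin'⟩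
  refine ⟨fun x m => ?_, key⟩
  obtain ⟨A, hA, y, hy, h⟩ := key x m
  exact ⟨A, hA, y, hy, fun z _ => h z⟩

end GreedyPaper
end
end
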